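/- Let f : ℝ^{3×3} → ℝ^{3×3×3} be an arbitrary function (the prediction network producing a third-order tensor from the canonical lattice). Let L ∈ ℝ^{3×3} be invertible and let Q' ∈ ℝ^{3×3} be orthogonal. If L = Q₀H₀ and Q'L = Q₁H₁ are polar decompositions (Q₀, Q₁ orthogonal; H₀, H₁ positive semidefinite), then ρ₃(Q₁) f(H₁) = ρ₃(Q') (ρ₃(Q₀) f(H₀)). That is, the canonicalized piezoelectric-tensor predictor h(L) = ρ₃(Q₀) f(H₀) is O(3)-equivariant: h(Q'L) = ρ₃(Q') h(L). -/

import Mathlib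

open Matrix

/-- The action of a `3 × 3` matrix on a third-order tensor:
`(ρ₃(Q)e)_{ijk} = Σ_{l,m,n} Q_{il} Q_{jm} Q_{kn} e_{lmn}`. -/
def rho3 (Q : Matrix (Fin 3) (Fin 3) ℝ) (e : Fin 3 → Fin 3 → Fin 3 → ℝ) :
    Fin 3 → Fin 3 → Fin 3 → ℝ :=
  fun i j k => ∑ l, ∑ m, ∑ n, Q i l * Q j m * Q k n * e l m n

theorem rho3_mul_aux (A B : Matrix (Fin 3) (Fin 3) ℝ) (e : Fin 3 → Fin 3 → Fin 3 → ℝ) :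
    rho3 (A * B) e = rho3 A (rho3 B e) := by
  have key : ∀ (M : Matrix (Fin 3) (Fin 3) ℝ) (g : Fin 3 → Fin 3 → Fin 3 → ℝ) (i j k : Fin 3),
      rho3 M g i j k = ∑ x : Fin 3 × Fin 3 × Fin 3,
        M i x.1 * M j x.2.1 * M k x.2.2 * g x.1 x.2.1 x.2.2 := by
    intro M g i j k
    simp only [rho3, Fintype.sum_prod_type]
  have h3 : ∀ u v w : Fin 3 → ℝ, (∑ p, u p) * (∑ q, v q) * (∑ r, w r) =
      ∑ x : Fin 3 × Fin 3 × Fin 3, u x.1 * v x.2.1 * w x.2.2 := by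
    intro u v w
    simp only [Fintype.sum_prod_type, Fin.sum_univ_three]
    ring
  funext i j k
  rw [key, key]
  simp only [key, Matrix.mul_apply, h3]
  simp only [Finset.sum_mul, Finset.mul_sum]
  rw [Finset.sum_comm]
  refine Finset.sum_congr rfl fun x _ => Finset.sum_congr rfl fun y _ => ?_
  ring

open scoped MatrixOrder Matrix.Norms.L2Operator in
theorem psd_sq_inj_aux (A B : Matrix (Fin 3) (Fin 3) ℝ) (hA : A.PosSemidef) (hB : B.PosSemidef)
    (h : A * A = B * B) : A = B := by
  have hA' : 0 ≤ A := hA.nonneg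
  have hB' : 0 ≤ B := hB.nonneg
  rw [← CFC.sqrt_unique h hA', CFC.sqrt_mul_self B hB']

/-- The canonicalized piezoelectric-tensor predictor `h(L) = ρ₃(Q₀) f(H₀)` (with
`L = Q₀H₀` the polar decomposition) is `O(3)`-equivariant: `h(Q'L) = ρ₃(Q') h(L)`. -/
theorem canonicalized_piezoelectric_predictor_equivariant
    (f : Matrix (Fin 3) (Fin 3) ℝ → (Fin 3 → Fin 3 → Fin 3 → ℝ))
    (L Q' Q₀ H₀ Q₁ H₁ : Matrix (Fin 3) (Fin 3) ℝ)
    (hL : IsUnit L)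
    (hQ' : Q'ᵀ * Q' = 1)
    (hQ₀ : Q₀ᵀ * Q₀ = 1) (hH₀ : H₀.PosSemidef) (hL₀ : L = Q₀ * H₀)
    (hQ₁ : Q₁ᵀ * Q₁ = 1) (hH₁ : H₁.PosSemidef) (hL₁ : Q' * L = Q₁ * H₁) :
    rho3 Q₁ (f H₁) = rho3 Q' (rho3 Q₀ (f H₀)) := by
  have t0 : H₀ᵀ = H₀ := by simpa using hH₀.isHermitian.eq
  have t1 : H₁ᵀ = H₁ := by simpa using hH₁.isHermitian.eq
  have e1 : (Q' * L)ᵀ * (Q' * L) = H₁ * H₁ := by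
    rw [hL₁, Matrix.transpose_mul, t1, Matrix.mul_assoc, ← Matrix.mul_assoc Q₁ᵀ, hQ₁,
      Matrix.one_mul]
  have e0 : (Q' * L)ᵀ * (Q' * L) = H₀ * H₀ := by
    rw [Matrix.transpose_mul, Matrix.mul_assoc, ← Matrix.mul_assoc Q'ᵀ, hQ', Matrix.one_mul,
      hL₀, Matrix.transpose_mul, t0, Matrix.mul_assoc, ← Matrix.mul_assoc Q₀ᵀ, hQ₀,
      Matrix.one_mul]
  have hH : H₁ = H₀ := psd_sq_inj_aux _ _ hH₁ hH₀ (e1.symm.trans e0)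
  subst hH
  have hU : IsUnit H₁ := by
    have : H₁ = Q₀ᵀ * L := by rw [hL₀, ← Matrix.mul_assoc, hQ₀, Matrix.one_mul]
    rw [this]
    exact (IsUnit.of_mul_eq_one _ hQ₀).mul hL
  have hQ : Q₁ = Q' * Q₀ := by
    apply hU.mul_right_cancel
    rw [← hL₁, hL₀, Matrix.mul_assoc]
  rw [hQ, rho3_mul_aux]
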